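/- Let n ≥ 3 and m ≥ 1 be integers. In the graph G_n^m, the random walk group centrality of S_K is strictly smaller than that of S_T: h(S_K) < h(S_T). -/

import Mathlib

open scoped ENNReal Classical

/-- Probability that the random walk with transition kernel `p`, started at `u`,
hits the set `S` for the first time in exactly `n` steps. -/
noncomputable def firstHitProb {α : Type*} [Fintype α] (p : α → α → ℝ≥0∞) (S : Set α) :
    ℕ → α → ℝ≥0∞
  | 0, u => if u ∈ S then 1 else 0
  | n + 1, u => if u ∈ S then 0 else ∑ w, p u w * firstHitProb p S n w

/-- Hitting time `H(u,S)`: expected number of steps the walk with kernel `p`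
started at `u` takes to reach a vertex of `S` for the first time. -/
noncomputable def hitTime {α : Type*} [Fintype α] (p : α → α → ℝ≥0∞) (S : Set α) (u : α) :
    ℝ≥0∞ :=
  ∑' n : ℕ, (n : ℝ≥0∞) * firstHitProb p S n u

/-- Transition kernel of the simple random walk on a graph with adjacency relation `A`:
from `x` move to each neighbour with equal probability `1/d(x)`. -/
noncomputable def unifKernel {α : Type*} [Fintype α] (A : α → α → Prop) (x y : α) : ℝ≥0∞ :=
  if A x y then ((Finset.univ.filter (A x)).card : ℝ≥0∞)⁻¹ else 0

/-- Random walk group centrality `h(S) = (Σ_{v∈V\S} H(v,S)) / |V\S|`. -/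
noncomputable def rwCentrality {V : Type*} [Fintype V] (G : SimpleGraph V) (S : Set V) :
    ℝ≥0∞ :=
  (∑ v ∈ Finset.univ.filter (fun v : V => v ∉ S), hitTime (unifKernel G.Adj) S v) /
    ((Finset.univ.filter (fun v : V => v ∉ S)).card : ℝ≥0∞)

/-- Vertices of the graph `G_n^m`: a central vertex `v` (the `Sum.inl` summand),
the vertices `(i,j)` of the cliques `K_n^i` (the first `Sum.inr ∘ Sum.inl` summand,
with `j = 0` the designated vertex `k_n^i`), and the vertices `(i,j)` of the stars
`T_n^i` (the second summand, with `j = 0` the root `t_n^i`). -/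
abbrev GnmVertex (n m : ℕ) : Type := Unit ⊕ (Fin m × Fin n) ⊕ (Fin m × Fin n)

/-- Generating relation for `G_n^m`: `v` is joined to each `k_n^i` and each `t_n^i`;
each clique copy `K_n^i` is complete; in each star `T_n^i` the root `t_n^i` is joined
to every other vertex of `T_n^i`. -/
def gnmRel (n m : ℕ) : GnmVertex n m → GnmVertex n m → Prop
  | Sum.inl _, Sum.inr (Sum.inl (_, j)) => (j : ℕ) = 0
  | Sum.inl _, Sum.inr (Sum.inr (_, j)) => (j : ℕ) = 0
  | Sum.inr (Sum.inl (i, _)), Sum.inr (Sum.inl (i', _)) => i = i'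
  | Sum.inr (Sum.inr (i, j)), Sum.inr (Sum.inr (i', j')) =>
      i = i' ∧ ((j : ℕ) = 0 ∨ (j' : ℕ) = 0)
  | _, _ => False

/-- The graph `G_n^m`: a central vertex `v`, `m` disjoint copies of the complete graph
`K_n` each joined to `v` by a single edge through its designated vertex `k_n^i`, and
`m` disjoint stars (trees of height 1) on `n` vertices whose roots `t_n^i` are adjacent
to `v`. -/
def Gnm (n m : ℕ) : SimpleGraph (GnmVertex n m) := SimpleGraph.fromRel (gnmRel n m)

/-- The set `S_K = {v, k_n^1, …, k_n^m}`. -/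
def setSK (n m : ℕ) : Set (GnmVertex n m) :=
  {x | x = Sum.inl () ∨ ∃ (i : Fin m) (j : Fin n), (j : ℕ) = 0 ∧ x = Sum.inr (Sum.inl (i, j))}

/-- The set `S_T = {v, t_n^1, …, t_n^m}`. -/
def setST (n m : ℕ) : Set (GnmVertex n m) :=
  {x | x = Sum.inl () ∨ ∃ (i : Fin m) (j : Fin n), (j : ℕ) = 0 ∧ x = Sum.inr (Sum.inr (i, j))}

theorem exists_killed_iterate {α : Type*} [Fintype α] (p : α → α → ℝ≥0∞) (S : Set α)
    (g : α → ℝ≥0∞) : ∃ q : ℕ → α → ℝ≥0∞, (∀ u, q 0 u = g u) ∧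
      ∀ n u, q (n+1) u = if u ∈ S then 0 else ∑ w, p u w * q n w :=
  ⟨fun n => Nat.rec g (fun _ h u => if u ∈ S then 0 else ∑ w, p u w * h w) n,
    fun _ => rfl, fun _ _ => rfl⟩

open scoped Topology in
open Filter in
/-- A finite solution of the hitting time equations is the hitting time. -/
theorem hitTime_eq_of_system {α : Type*} [Fintype α] (p : α → α → ℝ≥0∞) (S : Set α)
    (f : α → ℝ≥0∞) (M : ℝ≥0∞) (hM : M ≠ ⊤) (hfM : ∀ u, f u ≤ M)
    (hp : ∀ u, u ∉ S → ∑ w, p u w = 1)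
    (hS : ∀ u, u ∈ S → f u = 0)
    (hf : ∀ u, u ∉ S → f u = 1 + ∑ w, p u w * f w) (u : α) :
    hitTime p S u = f u := by
  have hex := exists_killed_iterate p S
  obtain ⟨q, q0, qs⟩ := hex (fun u => if u ∈ S then 0 else 1)
  obtain ⟨r, r0, rs⟩ := hex f
  have hA : ∀ n u, q n u = firstHitProb p S (n+1) u + q (n+1) u := by
    intro n
    induction n with
    | zero =>
      intro u
      by_cases hu : u ∈ S
      · simp [qs, q0, firstHitProb, hu]
      · rw [q0, qs]
        simp only [firstHitProb, hu, if_false, q0]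
        rw [← Finset.sum_add_distrib]
        refine (hp u hu).symm.trans ?_
        refine Finset.sum_congr rfl fun w _ => ?_
        by_cases hw : w ∈ S <;> simp [hw]
    | succ n ih =>
      intro u
      by_cases hu : u ∈ S
      · simp [qs, firstHitProb, hu]
      · rw [qs, qs, firstHitProb]
        simp only [hu, if_false]
        rw [← Finset.sum_add_distrib]
        refine Finset.sum_congr rfl fun w _ => ?_
        rw [ih w, mul_add]
  have hB : ∀ n u, r n u = q n u + r (n+1) u := by
    intro n
    induction n with
    | zero =>
      intro u
      by_cases hu : u ∈ S
      · simp [rs, q0, r0, hu, hS]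
      · rw [q0, rs, r0]
        simp only [hu, if_false, r0]
        exact hf u hu
    | succ n ih =>
      intro u
      by_cases hu : u ∈ S
      · simp [qs, rs, hu]
      · rw [qs, rs, rs]
        simp only [hu, if_false]
        rw [← Finset.sum_add_distrib]
        refine Finset.sum_congr rfl fun w _ => ?_
        rw [ih w, mul_add]
  have hC : ∀ n u, r n u ≤ M * q n u := by
    intro n
    induction n with
    | zero =>
      intro u
      by_cases hu : u ∈ S
      · simp [q0, r0, hu, hS]
      · simpa [q0, r0, hu] using hfM u
    | succ n ih =>
      intro u
      by_cases hu : u ∈ S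
      · simp [qs, rs, hu]
      · rw [qs, rs]
        simp only [hu, if_false]
        rw [Finset.mul_sum]
        refine Finset.sum_le_sum fun w _ => ?_
        rw [mul_left_comm]
        gcongr
        exact ih w
  have hsum : ∀ N u, f u = ∑ k ∈ Finset.range N, q k u + r N u := by
    intro N u
    induction N with
    | zero => simp [r0]
    | succ N ih => rw [Finset.sum_range_succ, add_assoc, ← hB, ← ih]
  have hfin : ∑' k, q k u ≠ ⊤ := by
    refine ne_top_of_le_ne_top (ne_top_of_le_ne_top hM (hfM u)) ?_
    refine ENNReal.tsum_le_of_sum_range_le fun N => ?_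
    rw [hsum N u]
    exact le_self_add
  have hq0 : Tendsto (fun k => q k u) atTop (𝓝 0) :=
    ENNReal.tendsto_atTop_zero_of_tsum_ne_top hfin
  have hr0 : Tendsto (fun k => r k u) atTop (𝓝 0) := by
    have h2 : Tendsto (fun k => M * q k u) atTop (𝓝 (M * 0)) :=
      ENNReal.Tendsto.const_mul hq0 (Or.inr hM)
    rw [mul_zero] at h2
    exact tendsto_of_tendsto_of_tendsto_of_le_of_le tendsto_const_nhds h2
      (fun _ => zero_le) (fun k => hC k u)
  have hfq : f u = ∑' k, q k u := by
    have h1 : Tendsto (fun N => ∑ k ∈ Finset.range N, q k u + r N u) atTop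
        (𝓝 (∑' k, q k u + 0)) := (ENNReal.tendsto_nat_tsum _).add hr0
    rw [add_zero] at h1
    refine tendsto_nhds_unique ?_ h1
    simp_rw [← hsum]
    exact tendsto_const_nhds
  have hqt : ∀ k, q k u = ∑' j, firstHitProb p S (j + (k+1)) u := by
    intro k
    have hpart : ∀ N, q k u =
        ∑ j ∈ Finset.range N, firstHitProb p S (j + (k+1)) u + q (N + k) u := by
      intro N
      induction N with
      | zero => simp
      | succ N ih =>
        rw [Finset.sum_range_succ, add_assoc]
        have := hA (N + k) u
        rw [show N + 1 + k = N + k + 1 by ring, ← add_assoc N k 1, ← this, ← ih]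
    have h1 : Tendsto (fun N => ∑ j ∈ Finset.range N, firstHitProb p S (j + (k+1)) u
        + q (N + k) u) atTop (𝓝 (∑' j, firstHitProb p S (j + (k+1)) u + 0)) :=
      (ENNReal.tendsto_nat_tsum _).add ((tendsto_add_atTop_iff_nat k).2 hq0)
    rw [add_zero] at h1
    refine tendsto_nhds_unique ?_ h1
    simp_rw [← hpart]
    exact tendsto_const_nhds
  rw [hfq, hitTime]
  have e1 : ∀ n : ℕ, (n : ℝ≥0∞) * firstHitProb p S n u =
      ∑' k : ℕ, if k < n then firstHitProb p S n u else 0 := by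
    intro n
    rw [tsum_eq_sum (s := Finset.range n) (by intro b hb; simp at hb; simp [hb])]
    rw [Finset.sum_congr rfl (g := fun _ => firstHitProb p S n u)
      (by intro x hx; simp at hx; simp [hx])]
    simp
  simp_rw [e1]
  rw [ENNReal.tsum_comm]
  refine tsum_congr fun k => ?_
  rw [hqt k]
  have hsplit := Summable.sum_add_tsum_nat_add' (k := k+1)
    (f := fun n : ℕ => if k < n then firstHitProb p S n u else 0) ENNReal.summable
  refine hsplit.symm.trans ?_
  rw [Finset.sum_eq_zero, zero_add]
  · refine tsum_congr fun j => ?_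
    rw [if_pos (by omega)]
  · intro x hx
    simp at hx
    rw [if_neg (by omega)]

/-- Version for simple random walks, with equations over the natural numbers. -/
theorem hitTime_unif_eq {α : Type*} [Fintype α] (A : α → α → Prop) (S : Set α) (f : α → ℕ)
    (hS : ∀ u, u ∈ S → f u = 0)
    (hd : ∀ u, u ∉ S → ∑ w, (if A u w then 1 else 0) ≠ 0)
    (hf : ∀ u, u ∉ S → (∑ w, if A u w then 1 else 0) * f u =
      (∑ w, if A u w then 1 else 0) + ∑ w, if A u w then f w else 0) (u : α) :
    hitTime (unifKernel A) S u = f u := by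
  have key : ∀ u (g : α → ℕ), ∑ w, unifKernel A u w * (g w : ℝ≥0∞) =
      ((∑ w, (if A u w then 1 else 0) : ℕ) : ℝ≥0∞)⁻¹ *
        ((∑ w, if A u w then g w else 0 : ℕ) : ℝ≥0∞) := by
    intro u g
    push_cast
    rw [Finset.mul_sum]
    refine Finset.sum_congr rfl fun w _ => ?_
    unfold unifKernel
    by_cases h : A u w <;> simp [h]
  have hdi : ∀ u, u ∉ S → ((∑ w, (if A u w then 1 else 0) : ℕ) : ℝ≥0∞)⁻¹ *
      ((∑ w, (if A u w then 1 else 0) : ℕ) : ℝ≥0∞) = 1 := fun u hu =>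
    ENNReal.inv_mul_cancel (Nat.cast_ne_zero.2 (hd u hu)) (ENNReal.natCast_ne_top _)
  refine hitTime_eq_of_system (unifKernel A) S (fun u => (f u : ℝ≥0∞))
    ((∑ w, f w : ℕ) : ℝ≥0∞) (ENNReal.natCast_ne_top _) ?_ ?_ ?_ ?_ u
  · intro u
    exact Nat.cast_le.2 (Finset.single_le_sum (fun _ _ => Nat.zero_le _) (Finset.mem_univ u))
  · intro u hu
    have := key u (fun _ => 1)
    rw [hdi u hu] at this
    simpa using this
  · intro u hu
    simp [hS u hu]
  · intro u hu
    rw [key u f]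
    nth_rewrite 1 [← hdi u hu]
    rw [← mul_add, ← Nat.cast_add, ← hf u hu, Nat.cast_mul, ← mul_assoc, hdi u hu, one_mul]

theorem gnm_sum_clique (k m : ℕ) (i : Fin m) (j : Fin (k+1)) (g : GnmVertex (k+1) m → ℕ) :
    (∑ w, if (Gnm (k+1) m).Adj (Sum.inr (Sum.inl (i, j))) w then g w else 0)
      + g (Sum.inr (Sum.inl (i, j))) =
    (if j = 0 then g (Sum.inl ()) else 0) + ∑ j', g (Sum.inr (Sum.inl (i, j'))) := by
  have h1 : g (Sum.inr (Sum.inl (i, j))) =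
      ∑ j', if j' = j then g (Sum.inr (Sum.inl (i, j'))) else 0 := by simp
  have h2 : ∑ j', g (Sum.inr (Sum.inl (i, j'))) =
      (∑ j', if j' ≠ j then g (Sum.inr (Sum.inl (i, j'))) else 0) +
      g (Sum.inr (Sum.inl (i, j))) := by
    rw [h1, ← Finset.sum_add_distrib]
    refine Finset.sum_congr rfl fun w _ => ?_
    by_cases h : w = j <;> simp [h]
  rw [h2, ← add_assoc]
  congr 1
  rw [Fintype.sum_sum_type, Fintype.sum_sum_type, Fintype.sum_prod_type, Fintype.sum_prod_type]
  simp only [Gnm, SimpleGraph.fromRel_adj, gnmRel]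
  rw [Finset.sum_eq_single (a := i)]
  · simp [eq_comm]
  · intro b _ hb
    simp [hb, hb.symm]
  · simp

theorem gnm_sum_root (k m : ℕ) (i : Fin m) (g : GnmVertex (k+1) m → ℕ) :
    (∑ w, if (Gnm (k+1) m).Adj (Sum.inr (Sum.inr (i, 0))) w then g w else 0) =
    g (Sum.inl ()) + ∑ j' : Fin k, g (Sum.inr (Sum.inr (i, j'.succ))) := by
  have e1 : (Gnm (k+1) m).Adj (Sum.inr (Sum.inr (i, 0))) (Sum.inl ()) := by
    simp [Gnm, gnmRel]
  have e2 : ∀ x, ¬ (Gnm (k+1) m).Adj (Sum.inr (Sum.inr (i, 0))) (Sum.inr (Sum.inl x)) := by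
    simp [Gnm, gnmRel]
  have e3 : ∀ x y, (Gnm (k+1) m).Adj (Sum.inr (Sum.inr (i, 0))) (Sum.inr (Sum.inr (x, y))) ↔
      x = i ∧ y ≠ 0 := by
    intro x y
    simp [Gnm, gnmRel]
    grind
  rw [Fintype.sum_sum_type, Fintype.sum_sum_type, Fintype.sum_prod_type, Fintype.sum_prod_type]
  simp only [e2, e3, if_false]
  have e4 : (∑ x, ∑ y, if x = i ∧ y ≠ 0 then g (Sum.inr (Sum.inr (x, y))) else 0) =
      ∑ j' : Fin k, g (Sum.inr (Sum.inr (i, j'.succ))) := by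
    rw [Finset.sum_eq_single i (by intro b _ hb; simp [hb]) (by simp)]
    simp [Fin.sum_univ_succ]
  rw [e4]
  simp [e1]

theorem gnm_sum_leaf (k m : ℕ) (i : Fin m) (j : Fin k) (g : GnmVertex (k+1) m → ℕ) :
    (∑ w, if (Gnm (k+1) m).Adj (Sum.inr (Sum.inr (i, j.succ))) w then g w else 0) =
    g (Sum.inr (Sum.inr (i, 0))) := by
  rw [Finset.sum_eq_single (a := Sum.inr (Sum.inr (i, 0)))]
  · simp [Gnm, gnmRel]
  · rintro (b | ⟨a, b⟩ | ⟨a, b⟩) _ hb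
    · simp [Gnm, gnmRel]
    · simp [Gnm, gnmRel]
    · simp [Gnm, gnmRel] at hb ⊢
      grind
  · simp

/-- Hitting times of `S_K`. -/
def hitK (k m : ℕ) : GnmVertex (k+1) m → ℕ
  | Sum.inl _ => 0
  | Sum.inr (Sum.inl (_, j)) => if j = 0 then 0 else k
  | Sum.inr (Sum.inr (_, j)) => if j = 0 then 2 * k + 1 else 2 * k + 2

/-- Hitting times of `S_T`. -/
def hitT (k m : ℕ) : GnmVertex (k+1) m → ℕ
  | Sum.inl _ => 0
  | Sum.inr (Sum.inl (_, j)) => if j = 0 then (k + 1) * k + 1 else (k + 1) * k + 1 + k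
  | Sum.inr (Sum.inr (_, j)) => if j = 0 then 0 else 1

theorem hitTime_K (k m : ℕ) (hk : 2 ≤ k) (u : GnmVertex (k+1) m) :
    hitTime (unifKernel (Gnm (k+1) m).Adj) (setSK (k+1) m) u = hitK k m u := by
  have a1 := fun i j => gnm_sum_clique k m i j (hitK k m)
  have a2 := fun i j => gnm_sum_clique k m i j (fun _ => 1)
  have b1 := fun i => gnm_sum_root k m i (hitK k m)
  have b2 := fun i => gnm_sum_root k m i (fun _ => 1)
  have c1 := fun i j => gnm_sum_leaf k m i j (hitK k m)
  have c2 := fun i j => gnm_sum_leaf k m i j (fun _ => 1)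
  have main : ∀ u, u ∉ setSK (k+1) m →
      (∑ w, (if (Gnm (k+1) m).Adj u w then 1 else 0) ≠ 0) ∧
      (∑ w, if (Gnm (k+1) m).Adj u w then 1 else 0) * hitK k m u =
      (∑ w, if (Gnm (k+1) m).Adj u w then 1 else 0) +
        ∑ w, if (Gnm (k+1) m).Adj u w then hitK k m w else 0 := by
    rintro (b | ⟨a, b⟩ | ⟨a, b⟩) hu
    · simp [setSK] at hu
    · have hb : b ≠ 0 := by
        rintro rfl
        exact hu (Or.inr ⟨a, 0, rfl, rfl⟩)
      have a1 := a1 a b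
      have a2 := a2 a b
      generalize (∑ w, if (Gnm (k+1) m).Adj (Sum.inr (Sum.inl (a, b))) w then 1 else 0) = X at *
      generalize (∑ w, if (Gnm (k+1) m).Adj (Sum.inr (Sum.inl (a, b))) w
        then hitK k m w else 0) = Y at *
      simp [hitK, hb, Fin.sum_univ_succ] at a1 a2 ⊢
      subst a2
      exact ⟨by omega, by rw [← a1, add_comm]⟩
    · refine Fin.cases ?_ (fun j => ?_) b
      · rw [b1, b2]
        simp [hitK, Fin.sum_univ_succ]
        ring
      · rw [c1, c2]
        simp [hitK]
        ring
  refine hitTime_unif_eq _ _ _ ?_ (fun u hu => (main u hu).1) (fun u hu => (main u hu).2) u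
  rintro u (rfl | ⟨i, j, hj, rfl⟩)
  · rfl
  · simp [hitK, Fin.ext_iff, hj]

theorem hitTime_T (k m : ℕ) (hk : 2 ≤ k) (u : GnmVertex (k+1) m) :
    hitTime (unifKernel (Gnm (k+1) m).Adj) (setST (k+1) m) u = hitT k m u := by
  have a1 := fun i j => gnm_sum_clique k m i j (hitT k m)
  have a2 := fun i j => gnm_sum_clique k m i j (fun _ => 1)
  have c1 := fun i j => gnm_sum_leaf k m i j (hitT k m)
  have c2 := fun i j => gnm_sum_leaf k m i j (fun _ => 1)
  have main : ∀ u, u ∉ setST (k+1) m →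
      (∑ w, (if (Gnm (k+1) m).Adj u w then 1 else 0) ≠ 0) ∧
      (∑ w, if (Gnm (k+1) m).Adj u w then 1 else 0) * hitT k m u =
      (∑ w, if (Gnm (k+1) m).Adj u w then 1 else 0) +
        ∑ w, if (Gnm (k+1) m).Adj u w then hitT k m w else 0 := by
    rintro (b | ⟨a, b⟩ | ⟨a, b⟩) hu
    · simp [setST] at hu
    · have a1 := a1 a b
      have a2 := a2 a b
      generalize (∑ w, if (Gnm (k+1) m).Adj (Sum.inr (Sum.inl (a, b))) w then 1 else 0) = X at *
      generalize (∑ w, if (Gnm (k+1) m).Adj (Sum.inr (Sum.inl (a, b))) w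
        then hitT k m w else 0) = Y at *
      by_cases hb : b = 0
      · simp [hitT, hb, Fin.sum_univ_succ] at a1 a2 ⊢
        have : X = k + 1 := by omega
        subst this
        exact ⟨by omega, by nlinarith⟩
      · simp [hitT, hb, Fin.sum_univ_succ] at a1 a2 ⊢
        subst a2
        exact ⟨by omega, by nlinarith⟩
    · revert hu
      refine Fin.cases ?_ (fun j => ?_) b
      · intro hu
        exact absurd (Or.inr ⟨a, 0, rfl, rfl⟩) hu
      · intro _
        rw [c1, c2]
        simp [hitT]
  refine hitTime_unif_eq _ _ _ ?_ (fun u hu => (main u hu).1) (fun u hu => (main u hu).2) u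
  rintro u (rfl | ⟨i, j, hj, rfl⟩)
  · rfl
  · simp [hitT, Fin.ext_iff, hj]

theorem gnm_card_K (k m : ℕ) :
    (Finset.univ.filter (fun v : GnmVertex (k+1) m => v ∉ setSK (k+1) m)).card
      = m * (2 * k + 1) := by
  rw [Finset.card_filter, Fintype.sum_sum_type, Fintype.sum_sum_type, Fintype.sum_prod_type,
    Fintype.sum_prod_type]
  simp [setSK, Fin.sum_univ_succ]
  ring

theorem gnm_card_T (k m : ℕ) :
    (Finset.univ.filter (fun v : GnmVertex (k+1) m => v ∉ setST (k+1) m)).card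
      = m * (2 * k + 1) := by
  rw [Finset.card_filter, Fintype.sum_sum_type, Fintype.sum_sum_type, Fintype.sum_prod_type,
    Fintype.sum_prod_type]
  simp [setST, Fin.sum_univ_succ]
  ring

theorem gnm_sum_K (k m : ℕ) :
    ∑ v ∈ Finset.univ.filter (fun v : GnmVertex (k+1) m => v ∉ setSK (k+1) m), hitK k m v
      = m * (k * k + (2 * k + 1) + k * (2 * k + 2)) := by
  rw [Finset.sum_filter, Fintype.sum_sum_type, Fintype.sum_sum_type, Fintype.sum_prod_type,
    Fintype.sum_prod_type]
  simp [setSK, Fin.sum_univ_succ, hitK]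
  ring

theorem gnm_sum_T (k m : ℕ) :
    ∑ v ∈ Finset.univ.filter (fun v : GnmVertex (k+1) m => v ∉ setST (k+1) m), hitT k m v
      = m * (((k + 1) * k + 1) + k * ((k + 1) * k + 1 + k) + k) := by
  rw [Finset.sum_filter, Fintype.sum_sum_type, Fintype.sum_sum_type, Fintype.sum_prod_type,
    Fintype.sum_prod_type]
  simp [setST, Fin.sum_univ_succ, hitT]
  ring

/-- For integers `n ≥ 3` and `m ≥ 1`, in the graph `G_n^m` the random walk
group centrality of `S_K` is strictly smaller than that of `S_T`. -/
theorem rwCentrality_SK_lt_ST (n m : ℕ) (hn : 3 ≤ n) (hm : 1 ≤ m) :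
    rwCentrality (Gnm n m) (setSK n m) < rwCentrality (Gnm n m) (setST n m) := by
  obtain ⟨k, rfl⟩ : ∃ k, n = k + 1 := ⟨n - 1, by omega⟩
  have hk : 2 ≤ k := by omega
  unfold rwCentrality
  simp_rw [hitTime_K k m hk, hitTime_T k m hk]
  rw [← Nat.cast_sum, ← Nat.cast_sum, gnm_sum_K, gnm_sum_T, gnm_card_K, gnm_card_T]
  apply ENNReal.div_lt_div_right
  · exact Nat.cast_ne_zero.2 (by positivity)
  · exact ENNReal.natCast_ne_top _
  · refine Nat.cast_lt.2 (Nat.mul_lt_mul_of_pos_left ?_ hm)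
    obtain ⟨l, rfl⟩ := Nat.exists_eq_add_of_le hk
    ring_nf
    nlinarith [Nat.zero_le l, Nat.zero_le (l^2), Nat.zero_le (l^3)]
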